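/- Let π : U → B be the ℂ-linear projection onto B along the left ideal U(E − c), relative to the direct sum decomposition U = B ⊕ U(E − c). Then the restriction of π to the center Z(U) is an injective ℂ-algebra homomorphism; its image is the subalgebra W of B generated by cF + (q^{2m}K^m + H^m)/((q^{2m} − 1)(q − q⁻¹)), KH, and (KH)⁻¹, and in particular π(Ω) = cF + (q^{2m}K^m + H^m)/((q^{2m} − 1)(q − q⁻¹)). -/

import Mathlib

noncomputable section

open FreeAlgebra

/-- Generators of the quantum group `U_q(f(K,H))`. -/
inductive Gen : Type
  | E | F | K | Kinv | H | Hinv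

/-- The free algebra on the generators. -/
abbrev FA : Type := FreeAlgebra ℂ Gen

def gE : FA := ι ℂ Gen.E
def gF : FA := ι ℂ Gen.F
def gK : FA := ι ℂ Gen.K
def gKi : FA := ι ℂ Gen.Kinv
def gH : FA := ι ℂ Gen.H
def gHi : FA := ι ℂ Gen.Hinv

/-- The defining relations of `U_q(f(K,H))`, where `r` is the element of the free
algebra representing the Laurent polynomial `f(K,H)` appearing in `EF - FE = f(K,H)`. -/
inductive URel (q : ℂ) (r : FA) : FA → FA → Prop
  | KKi : URel q r (gK * gKi) 1
  | KiK : URel q r (gKi * gK) 1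
  | HHi : URel q r (gH * gHi) 1
  | HiH : URel q r (gHi * gH) 1
  | KH  : URel q r (gK * gH) (gH * gK)
  | KE  : URel q r (gK * gE) (q ^ 2 • (gE * gK))
  | KF  : URel q r (gK * gF) ((q ^ 2)⁻¹ • (gF * gK))
  | HE  : URel q r (gH * gE) ((q ^ 2)⁻¹ • (gE * gH))
  | HF  : URel q r (gH * gF) (q ^ 2 • (gF * gH))
  | EF  : URel q r (gE * gF - gF * gE) r

/-- `U_q(f(K,H))` as a quotient of the free algebra. -/
abbrev Uq (q : ℂ) (r : FA) : Type := RingQuot (URel q r)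

variable (q : ℂ) (r : FA)

def uE : Uq q r := RingQuot.mkAlgHom ℂ (URel q r) gE
def uF : Uq q r := RingQuot.mkAlgHom ℂ (URel q r) gF
def uK : Uq q r := RingQuot.mkAlgHom ℂ (URel q r) gK
def uKi : Uq q r := RingQuot.mkAlgHom ℂ (URel q r) gKi
def uH : Uq q r := RingQuot.mkAlgHom ℂ (URel q r) gH
def uHi : Uq q r := RingQuot.mkAlgHom ℂ (URel q r) gHi

/-- The element `f_m(K,H) = (K^m - H^m)/(q - q⁻¹)` of the free algebra. -/
def fm (q : ℂ) (m : ℕ) : FA := (q - q⁻¹)⁻¹ • (gK ^ m - gH ^ m)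

/-- The quantum group `U_q(f_m(K,H))`. -/
abbrev Um (q : ℂ) (m : ℕ) : Type := Uq q (fm q m)

end
/-- The Casimir element `Ω = FE + (q^{2m}K^m + H^m)/((q^{2m} - 1)(q - q⁻¹))`. -/
noncomputable def Om (q : ℂ) (m : ℕ) : Um q m :=
  uF q (fm q m) * uE q (fm q m) +
    ((q ^ (2 * m) - 1) * (q - q⁻¹))⁻¹ •
      (q ^ (2 * m) • uK q (fm q m) ^ m + uH q (fm q m) ^ m)
/-- The subalgebra `B = U_q(F, K^{±1}, H^{±1})` of `U` generated by `F, K, K⁻¹, H, H⁻¹`. -/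
noncomputable def Bsub (q : ℂ) (m : ℕ) : Subalgebra ℂ (Um q m) :=
  Algebra.adjoin ℂ ({uF q (fm q m), uK q (fm q m), uKi q (fm q m),
    uH q (fm q m), uHi q (fm q m)} : Set (Um q m))

/-- The left ideal `U(E - c)` of `U` generated by `E - c`. -/
noncomputable def Lc (q : ℂ) (m : ℕ) (c : ℂ) : Submodule (Um q m) (Um q m) :=
  Submodule.span (Um q m) {uE q (fm q m) - algebraMap ℂ (Um q m) c}

/-- The element `cF + (q^{2m}K^m + H^m)/((q^{2m} - 1)(q - q⁻¹))`, the image of `Ω`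
under the projection onto `B` along `U(E - c)`. -/
noncomputable def OmEta (q : ℂ) (m : ℕ) (c : ℂ) : Um q m :=
  algebraMap ℂ (Um q m) c * uF q (fm q m) +
    ((q ^ (2 * m) - 1) * (q - q⁻¹))⁻¹ •
      (q ^ (2 * m) • uK q (fm q m) ^ m + uH q (fm q m) ^ m)

/-- The subalgebra `W` of `B` generated by
`cF + (q^{2m}K^m + H^m)/((q^{2m} - 1)(q - q⁻¹))`, `KH` and `(KH)⁻¹`. -/
noncomputable def Wsub (q : ℂ) (m : ℕ) (c : ℂ) : Subalgebra ℂ (Um q m) :=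
  Algebra.adjoin ℂ ({OmEta q m c, uK q (fm q m) * uH q (fm q m),
    uKi q (fm q m) * uHi q (fm q m)} : Set (Um q m))

/-! ### Skew-commuting elements -/

section SkewCommute

variable {A : Type*} [Ring A] [Algebra ℂ A]

lemma skew_pow_left {s : ℂ} {x e : A} (h : x * e = s • (e * x)) (n : ℕ) :
    x ^ n * e = s ^ n • (e * x ^ n) := by
  induction n with
  | zero => simp
  | succ n ih =>
    rw [pow_succ, mul_assoc, h, mul_smul_comm, ← mul_assoc, ih, smul_mul_assoc, smul_smul,
      mul_assoc, pow_succ']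

lemma skew_pow_right {s : ℂ} {x e : A} (h : x * e = s • (e * x)) (n : ℕ) :
    x * e ^ n = s ^ n • (e ^ n * x) := by
  induction n with
  | zero => simp
  | succ n ih =>
    rw [pow_succ, ← mul_assoc, ih, smul_mul_assoc, mul_assoc, h, mul_smul_comm, smul_smul,
      ← mul_assoc, pow_succ]

lemma skew_inv {s : ℂ} (hs : s ≠ 0) {x y e : A} (hxy : x * y = 1) (hyx : y * x = 1)
    (h : x * e = s • (e * x)) : y * e = s⁻¹ • (e * y) := by
  have h1 : e * y = s • (y * e) := by
    calc e * y = y * (x * e) * y := by rw [← mul_assoc, hyx, one_mul]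
      _ = s • (y * e) := by
        rw [h, mul_smul_comm, smul_mul_assoc, mul_assoc, mul_assoc, hxy, mul_one]
  rw [h1, smul_smul, inv_mul_cancel₀ hs, one_smul]

/-- A submodule containing `1` and stable under left multiplication by a generating set
is everything. -/
lemma mem_of_adjoin_eq_top_of_mul_mem {s : Set A} (hs : Algebra.adjoin ℂ s = ⊤)
    (N : Submodule ℂ A) (h1 : 1 ∈ N) (hN : ∀ x ∈ s, ∀ y ∈ N, x * y ∈ N) (u : A) : u ∈ N := by
  have hu : u ∈ Algebra.adjoin ℂ s := hs ▸ Algebra.mem_top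
  have key : ∀ y ∈ N, u * y ∈ N := by
    induction hu using Algebra.adjoin_induction with
    | mem x hx => exact hN x hx
    | algebraMap r =>
      intro y hy
      rw [← Algebra.smul_def]
      exact N.smul_mem r hy
    | add a b _ _ ha hb =>
      intro y hy
      rw [add_mul]
      exact N.add_mem (ha y hy) (hb y hy)
    | mul a b _ _ ha hb =>
      intro y hy
      rw [mul_assoc]
      exact ha _ (hb y hy)
  simpa using key 1 h1

/-- If `x * e ∈ e * S` for all `x` in a set of generators of the subalgebra `S`, then
`x * e ∈ e * S` for all `x ∈ S`. -/
lemma exists_mul_eq_of_adjoin {s : Set A} {e : A}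
    (h : ∀ x ∈ s, ∃ y ∈ Algebra.adjoin ℂ s, x * e = e * y) {x : A}
    (hx : x ∈ Algebra.adjoin ℂ s) : ∃ y ∈ Algebra.adjoin ℂ s, x * e = e * y := by
  induction hx using Algebra.adjoin_induction with
  | mem x hx => exact h x hx
  | algebraMap r => exact ⟨_, Subalgebra.algebraMap_mem _ r, Algebra.commutes r e⟩
  | add a b _ _ ha hb =>
    obtain ⟨a', ha', hae⟩ := ha
    obtain ⟨b', hb', hbe⟩ := hb
    exact ⟨a' + b', add_mem ha' hb', by rw [add_mul, hae, hbe, mul_add]⟩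
  | mul a b _ _ ha hb =>
    obtain ⟨a', ha', hae⟩ := ha
    obtain ⟨b', hb', hbe⟩ := hb
    exact ⟨a' * b', mul_mem ha' hb', by rw [mul_assoc, hbe, ← mul_assoc, hae, mul_assoc]⟩

lemma exists_mul_pow_eq {S : Subalgebra ℂ A} {e : A}
    (h : ∀ x ∈ S, ∃ y ∈ S, x * e = e * y) (n : ℕ) :
    ∀ x ∈ S, ∃ y ∈ S, x * e ^ n = e ^ n * y := by
  induction n with
  | zero => exact fun x hx => ⟨x, hx, by simp⟩
  | succ n ih =>
    intro x hx
    obtain ⟨y, hy, hxy⟩ := ih x hx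
    obtain ⟨z, hz, hyz⟩ := h y hy
    exact ⟨z, hz, by rw [pow_succ, ← mul_assoc, hxy, mul_assoc, hyz, mul_assoc]⟩

end SkewCommute

/-! ### Algebras generated by elements satisfying the relations of `U_q(f_m(K,H))` -/

/-- The elements `E, F, K^{±1}, H^{±1}` generate the algebra `A` and satisfy the defining
relations of `U_q(f_m(K,H))`. -/
structure QuantumRelations (q : ℂ) (m : ℕ) {A : Type*} [Ring A] [Algebra ℂ A]
    (E F : A) (K H : Aˣ) : Prop where
  KH : Commute (K : A) H
  KE : (K : A) * E = q ^ 2 • (E * (K : A))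
  KF : (K : A) * F = (q ^ 2)⁻¹ • (F * (K : A))
  HE : (H : A) * E = (q ^ 2)⁻¹ • (E * (H : A))
  HF : (H : A) * F = q ^ 2 • (F * (H : A))
  EF : E * F - F * E = (q - q⁻¹)⁻¹ • ((K : A) ^ m - (H : A) ^ m)
  adjoin_eq_top :
    Algebra.adjoin ℂ {E, F, (K : A), ((K⁻¹ : Aˣ) : A), (H : A), ((H⁻¹ : Aˣ) : A)} = ⊤

section Casimir

variable {A : Type*} [Ring A] [Algebra ℂ A]

/-- The torus part `(q^{2m}K^m + H^m)/((q^{2m} - 1)(q - q⁻¹))` of the Casimir element. -/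
noncomputable def casimirTorus (q : ℂ) (m : ℕ) (K H : Aˣ) : A :=
  ((q ^ (2 * m) - 1) * (q - q⁻¹))⁻¹ • (q ^ (2 * m) • (K : A) ^ m + (H : A) ^ m)

/-- The Casimir element. -/
noncomputable def casimir (q : ℂ) (m : ℕ) (E F : A) (K H : Aˣ) : A :=
  F * E + casimirTorus q m K H

/-- The generators of the weight zero subalgebra. -/
def weightZeroGens (q : ℂ) (m : ℕ) (E F : A) (K H : Aˣ) : Set A :=
  {casimir q m E F K H, (K : A), ((K⁻¹ : Aˣ) : A), (H : A), ((H⁻¹ : Aˣ) : A)}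

/-- The weight zero subalgebra, generated by the Casimir element and the torus. -/
def weightZero (q : ℂ) (m : ℕ) (E F : A) (K H : Aˣ) : Subalgebra ℂ A :=
  Algebra.adjoin ℂ (weightZeroGens q m E F K H)

/-- The monomials `Ω^i K^a H^b`. -/
noncomputable def torusMonomial (q : ℂ) (m : ℕ) (E F : A) (K H : Aˣ) (t : ℕ × ℤ × ℤ) : A :=
  casimir q m E F K H ^ t.1 * ((K ^ t.2.1 : Aˣ) * (H ^ t.2.2 : Aˣ))

/-- The subalgebra generated by `F` and the torus. -/
def lowerBorel (F : A) (K H : Aˣ) : Subalgebra ℂ A :=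
  Algebra.adjoin ℂ {F, (K : A), ((K⁻¹ : Aˣ) : A), (H : A), ((H⁻¹ : Aˣ) : A)}

end Casimir

lemma q_sub_inv_ne_zero {q : ℂ} (hq0 : q ≠ 0) (hq : ∀ n : ℕ, 0 < n → q ^ n ≠ 1) :
    q - q⁻¹ ≠ 0 := by
  intro h
  apply hq 2 (by norm_num)
  have : q = q⁻¹ := sub_eq_zero.mp h
  rw [pow_two]
  nth_rewrite 2 [this]
  exact mul_inv_cancel₀ hq0

lemma q_zpow_ne_one {q : ℂ} (hq : ∀ n : ℕ, 0 < n → q ^ n ≠ 1) {n : ℤ} (hn : n ≠ 0) :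
    q ^ n ≠ 1 := by
  obtain ⟨k, rfl | rfl⟩ := n.eq_nat_or_neg
  · rw [zpow_natCast]
    exact hq k (by omega)
  · rw [zpow_neg, zpow_natCast, ne_eq, inv_eq_one]
    exact hq k (by omega)

namespace QuantumRelations

variable {A : Type*} [Ring A] [Algebra ℂ A] {q : ℂ} {m : ℕ} {E F : A} {K H : Aˣ}

section Commutation

variable (h : QuantumRelations q m E F K H)
include h

lemma K_pow_E : (K : A) ^ m * E = q ^ (2 * m) • (E * (K : A) ^ m) := by
  rw [skew_pow_left h.KE, pow_mul]

lemma H_pow_E : (H : A) ^ m * E = (q ^ (2 * m))⁻¹ • (E * (H : A) ^ m) := by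
  rw [skew_pow_left h.HE, pow_mul, inv_pow]

lemma K_pow_F : (K : A) ^ m * F = (q ^ (2 * m))⁻¹ • (F * (K : A) ^ m) := by
  rw [skew_pow_left h.KF, pow_mul, inv_pow]

lemma H_pow_F : (H : A) ^ m * F = q ^ (2 * m) • (F * (H : A) ^ m) := by
  rw [skew_pow_left h.HF, pow_mul]

lemma E_mul_F : E * F = F * E + (q - q⁻¹)⁻¹ • ((K : A) ^ m - (H : A) ^ m) := by
  rw [← h.EF]; abel

lemma commute_casimir_E (hq0 : q ≠ 0) (hq : ∀ n : ℕ, 0 < n → q ^ n ≠ 1) (hm : 1 ≤ m) :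
    Commute (casimir q m E F K H) E := by
  have h1 := q_sub_inv_ne_zero hq0 hq
  have h2 : q ^ (2 * m) - 1 ≠ 0 := sub_ne_zero.mpr (hq _ (by omega))
  have h3 : q ^ (2 * m) ≠ 0 := pow_ne_zero _ hq0
  unfold casimir casimirTorus
  rw [Commute, SemiconjBy, mul_add, ← mul_assoc, h.E_mul_F]
  generalize q - q⁻¹ = d at h1 ⊢
  simp only [add_mul, sub_mul, smul_mul_assoc, mul_smul_comm, mul_add, h.K_pow_E, h.H_pow_E]
  generalize q ^ (2 * m) = Q at h2 h3 ⊢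
  match_scalars <;> field_simp <;> ring

lemma commute_casimir_F (hq0 : q ≠ 0) (hq : ∀ n : ℕ, 0 < n → q ^ n ≠ 1) (hm : 1 ≤ m) :
    Commute (casimir q m E F K H) F := by
  have h1 := q_sub_inv_ne_zero hq0 hq
  have h2 : q ^ (2 * m) - 1 ≠ 0 := sub_ne_zero.mpr (hq _ (by omega))
  have h3 : q ^ (2 * m) ≠ 0 := pow_ne_zero _ hq0
  unfold casimir casimirTorus
  rw [Commute, SemiconjBy, add_mul, mul_assoc, h.E_mul_F]
  generalize q - q⁻¹ = d at h1 ⊢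
  simp only [add_mul, mul_sub, smul_mul_assoc, mul_smul_comm, mul_add, h.K_pow_F, h.H_pow_F]
  generalize q ^ (2 * m) = Q at h2 h3 ⊢
  match_scalars <;> field_simp <;> ring

omit h in
lemma commute_casimirTorus {x : A} (hK : Commute x K) (hH : Commute x H) :
    Commute x (casimirTorus q m K H) :=
  (((hK.pow_right m).smul_right _).add_right (hH.pow_right m)).smul_right _

lemma commute_K_casimir (hq0 : q ≠ 0) : Commute (K : A) (casimir q m E F K H) := by
  refine Commute.add_right ?_ (commute_casimirTorus (Commute.refl _) h.KH)
  rw [Commute, SemiconjBy, ← mul_assoc, h.KF, smul_mul_assoc, mul_assoc, h.KE, mul_smul_comm,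
    smul_smul, inv_mul_cancel₀ (pow_ne_zero 2 hq0), one_smul, mul_assoc]

lemma commute_H_casimir (hq0 : q ≠ 0) : Commute (H : A) (casimir q m E F K H) := by
  refine Commute.add_right ?_ (commute_casimirTorus h.KH.symm (Commute.refl _))
  rw [Commute, SemiconjBy, ← mul_assoc, h.HF, smul_mul_assoc, mul_assoc, h.HE, mul_smul_comm,
    smul_smul, mul_inv_cancel₀ (pow_ne_zero 2 hq0), one_smul, mul_assoc]

/-- An element is central once it commutes with `E, F, K, H`. -/
lemma mem_center_of_commute {x : A} (hE : Commute x E) (hF : Commute x F) (hK : Commute x K)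
    (hH : Commute x H) : x ∈ Subalgebra.center ℂ A := by
  have hle : Algebra.adjoin ℂ {E, F, (K : A), ((K⁻¹ : Aˣ) : A), (H : A), ((H⁻¹ : Aˣ) : A)} ≤
      Subalgebra.centralizer ℂ {x} := by
    rw [Algebra.adjoin_le_iff]
    rintro y (rfl | rfl | rfl | rfl | rfl | rfl) <;>
      simp only [SetLike.mem_coe, Subalgebra.mem_centralizer_iff, Set.mem_singleton_iff,
        forall_eq]
    exacts [hE, hF, hK, hK.units_inv_right, hH, hH.units_inv_right]
  rw [h.adjoin_eq_top] at hle
  rw [Subalgebra.mem_center_iff]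
  intro b
  exact ((Subalgebra.mem_centralizer_iff ℂ).mp (hle (Algebra.mem_top : b ∈ ⊤)) x rfl).symm

lemma casimir_mem_center (hq0 : q ≠ 0) (hq : ∀ n : ℕ, 0 < n → q ^ n ≠ 1) (hm : 1 ≤ m) :
    casimir q m E F K H ∈ Subalgebra.center ℂ A :=
  h.mem_center_of_commute (h.commute_casimir_E hq0 hq hm) (h.commute_casimir_F hq0 hq hm)
    (h.commute_K_casimir hq0).symm (h.commute_H_casimir hq0).symm

lemma K_mul_H_mem_center (hq0 : q ≠ 0) : ((K * H : Aˣ) : A) ∈ Subalgebra.center ℂ A := by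
  have hq2 : q ^ 2 ≠ 0 := pow_ne_zero 2 hq0
  refine h.mem_center_of_commute ?_ ?_ ?_ ?_
  · rw [Units.val_mul, Commute, SemiconjBy, mul_assoc, h.HE, mul_smul_comm, ← mul_assoc, h.KE,
      smul_mul_assoc, smul_smul, inv_mul_cancel₀ hq2, one_smul, mul_assoc]
  · rw [Units.val_mul, Commute, SemiconjBy, mul_assoc, h.HF, mul_smul_comm, ← mul_assoc, h.KF,
      smul_mul_assoc, smul_smul, mul_inv_cancel₀ hq2, one_smul, mul_assoc]
  · rw [Units.val_mul]
    exact (Commute.refl _).mul_left h.KH.symm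
  · rw [Units.val_mul]
    exact h.KH.mul_left (Commute.refl _)

omit h in
lemma units_inv_mem_center {u : Aˣ} (hu : (u : A) ∈ Subalgebra.center ℂ A) :
    ((u⁻¹ : Aˣ) : A) ∈ Subalgebra.center ℂ A := by
  rw [Subalgebra.mem_center_iff] at hu ⊢
  intro b
  exact Commute.units_inv_right (show Commute b u from hu b)

end Commutation

end QuantumRelations
namespace QuantumRelations

variable {A : Type*} [Ring A] [Algebra ℂ A] {q : ℂ} {m : ℕ} {E F : A} {K H : Aˣ}

section WeightZero

lemma casimir_mem_weightZero : casimir q m E F K H ∈ weightZero q m E F K H :=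
  Algebra.subset_adjoin (by simp [weightZeroGens])

lemma K_mem_weightZero : (K : A) ∈ weightZero q m E F K H :=
  Algebra.subset_adjoin (by simp [weightZeroGens])

lemma K_inv_mem_weightZero : ((K⁻¹ : Aˣ) : A) ∈ weightZero q m E F K H :=
  Algebra.subset_adjoin (by simp [weightZeroGens])

lemma H_mem_weightZero : (H : A) ∈ weightZero q m E F K H :=
  Algebra.subset_adjoin (by simp [weightZeroGens])

lemma H_inv_mem_weightZero : ((H⁻¹ : Aˣ) : A) ∈ weightZero q m E F K H :=
  Algebra.subset_adjoin (by simp [weightZeroGens])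

lemma F_mul_E_mem_weightZero : F * E ∈ weightZero q m E F K H := by
  have h1 : F * E = casimir q m E F K H - casimirTorus q m K H := by simp [casimir]
  rw [h1]
  refine sub_mem casimir_mem_weightZero (Subalgebra.smul_mem _ (add_mem ?_ ?_) _)
  · exact Subalgebra.smul_mem _ (pow_mem K_mem_weightZero m) _
  · exact pow_mem H_mem_weightZero m

variable (h : QuantumRelations q m E F K H)
include h

lemma E_mul_F_mem_weightZero : E * F ∈ weightZero q m E F K H := by
  rw [h.E_mul_F]
  exact add_mem F_mul_E_mem_weightZero (Subalgebra.smul_mem _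
    (sub_mem (pow_mem K_mem_weightZero m) (pow_mem H_mem_weightZero m)) _)

lemma exists_weightZero_mul_E (hq0 : q ≠ 0) (hq : ∀ n : ℕ, 0 < n → q ^ n ≠ 1) (hm : 1 ≤ m) :
    ∀ x ∈ weightZero q m E F K H, ∃ y ∈ weightZero q m E F K H, x * E = E * y := by
  have hq2 : q ^ 2 ≠ 0 := pow_ne_zero 2 hq0
  refine fun x hx => exists_mul_eq_of_adjoin ?_ hx
  rintro x (rfl | rfl | rfl | rfl | rfl)
  · exact ⟨_, casimir_mem_weightZero, h.commute_casimir_E hq0 hq hm⟩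
  · exact ⟨_, Subalgebra.smul_mem _ K_mem_weightZero (q ^ 2), by rw [h.KE, mul_smul_comm]⟩
  · exact ⟨_, Subalgebra.smul_mem _ K_inv_mem_weightZero (q ^ 2)⁻¹, by
      rw [skew_inv hq2 K.mul_inv K.inv_mul h.KE, mul_smul_comm]⟩
  · exact ⟨_, Subalgebra.smul_mem _ H_mem_weightZero (q ^ 2)⁻¹, by rw [h.HE, mul_smul_comm]⟩
  · exact ⟨_, Subalgebra.smul_mem _ H_inv_mem_weightZero (q ^ 2)⁻¹⁻¹, by
      rw [skew_inv (inv_ne_zero hq2) H.mul_inv H.inv_mul h.HE, mul_smul_comm]⟩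

lemma exists_weightZero_mul_F (hq0 : q ≠ 0) (hq : ∀ n : ℕ, 0 < n → q ^ n ≠ 1) (hm : 1 ≤ m) :
    ∀ x ∈ weightZero q m E F K H, ∃ y ∈ weightZero q m E F K H, x * F = F * y := by
  have hq2 : q ^ 2 ≠ 0 := pow_ne_zero 2 hq0
  refine fun x hx => exists_mul_eq_of_adjoin ?_ hx
  rintro x (rfl | rfl | rfl | rfl | rfl)
  · exact ⟨_, casimir_mem_weightZero, h.commute_casimir_F hq0 hq hm⟩
  · exact ⟨_, Subalgebra.smul_mem _ K_mem_weightZero (q ^ 2)⁻¹, by rw [h.KF, mul_smul_comm]⟩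
  · exact ⟨_, Subalgebra.smul_mem _ K_inv_mem_weightZero (q ^ 2)⁻¹⁻¹, by
      rw [skew_inv (inv_ne_zero hq2) K.mul_inv K.inv_mul h.KF, mul_smul_comm]⟩
  · exact ⟨_, Subalgebra.smul_mem _ H_mem_weightZero (q ^ 2), by rw [h.HF, mul_smul_comm]⟩
  · exact ⟨_, Subalgebra.smul_mem _ H_inv_mem_weightZero (q ^ 2)⁻¹, by
      rw [skew_inv hq2 H.mul_inv H.inv_mul h.HF, mul_smul_comm]⟩

/-- The elements `E^d y` and `F^d y`, with `y` of weight zero, span the algebra. -/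
lemma mem_span_pow_mul_weightZero (hq0 : q ≠ 0) (hq : ∀ n : ℕ, 0 < n → q ^ n ≠ 1)
    (hm : 1 ≤ m) (u : A) :
    u ∈ Submodule.span ℂ {x : A | ∃ d : ℕ, ∃ y ∈ weightZero q m E F K H,
      x = E ^ d * y ∨ x = F ^ d * y} := by
  set N := Submodule.span ℂ {x : A | ∃ d : ℕ, ∃ y ∈ weightZero q m E F K H,
      x = E ^ d * y ∨ x = F ^ d * y} with hN
  have hNE : ∀ (d : ℕ), ∀ y ∈ weightZero q m E F K H, E ^ d * y ∈ N := fun d y hy =>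
    Submodule.subset_span ⟨d, y, hy, Or.inl rfl⟩
  have hNF : ∀ (d : ℕ), ∀ y ∈ weightZero q m E F K H, F ^ d * y ∈ N := fun d y hy =>
    Submodule.subset_span ⟨d, y, hy, Or.inr rfl⟩
  have hzE := exists_mul_pow_eq (h.exists_weightZero_mul_E hq0 hq hm)
  have hzF := exists_mul_pow_eq (h.exists_weightZero_mul_F hq0 hq hm)
  have hN0 : ∀ x ∈ weightZero q m E F K H, ∀ v ∈ N, x * v ∈ N := by
    intro x hx v hv
    induction hv using Submodule.span_induction with
    | mem v hv =>
      obtain ⟨d, y, hy, rfl | rfl⟩ := hv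
      · obtain ⟨z, hz, hxz⟩ := hzE d x hx
        rw [← mul_assoc, hxz, mul_assoc]
        exact hNE d _ (mul_mem hz hy)
      · obtain ⟨z, hz, hxz⟩ := hzF d x hx
        rw [← mul_assoc, hxz, mul_assoc]
        exact hNF d _ (mul_mem hz hy)
    | zero => simp
    | add a b _ _ ha hb => rw [mul_add]; exact N.add_mem ha hb
    | smul r a _ ha => rw [mul_smul_comm]; exact N.smul_mem r ha
  refine mem_of_adjoin_eq_top_of_mul_mem h.adjoin_eq_top N (by simpa using hNE 0 1 (one_mem _)) ?_ u
  rintro x (rfl | rfl | rfl | rfl | rfl | rfl) v hv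
  · induction hv using Submodule.span_induction with
    | mem v hv =>
      obtain ⟨d, y, hy, rfl | rfl⟩ := hv
      · rw [← mul_assoc, ← pow_succ']
        exact hNE _ y hy
      · cases d with
        | zero => simpa using hNE 1 y hy
        | succ d =>
          obtain ⟨z, hz, hxz⟩ := hzF d _ h.E_mul_F_mem_weightZero
          rw [pow_succ', ← mul_assoc, ← mul_assoc, hxz, mul_assoc]
          exact hNF d _ (mul_mem hz hy)
    | zero => simp
    | add a b _ _ ha hb => rw [mul_add]; exact N.add_mem ha hb
    | smul r a _ ha => rw [mul_smul_comm]; exact N.smul_mem r ha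
  · induction hv using Submodule.span_induction with
    | mem v hv =>
      obtain ⟨d, y, hy, rfl | rfl⟩ := hv
      · cases d with
        | zero => simpa using hNF 1 y hy
        | succ d =>
          obtain ⟨z, hz, hxz⟩ := hzE d _
            (F_mul_E_mem_weightZero (m := m) (q := q) (K := K) (H := H))
          rw [pow_succ', ← mul_assoc, ← mul_assoc, hxz, mul_assoc]
          exact hNE d _ (mul_mem hz hy)
      · rw [← mul_assoc, ← pow_succ']
        exact hNF _ y hy
    | zero => simp
    | add a b _ _ ha hb => rw [mul_add]; exact N.add_mem ha hb
    | smul r a _ ha => rw [mul_smul_comm]; exact N.smul_mem r ha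
  · exact hN0 _ K_mem_weightZero v hv
  · exact hN0 _ K_inv_mem_weightZero v hv
  · exact hN0 _ H_mem_weightZero v hv
  · exact hN0 _ H_inv_mem_weightZero v hv

lemma commute_K_of_mem_weightZero (hq0 : q ≠ 0) {x : A} (hx : x ∈ weightZero q m E F K H) :
    Commute (K : A) x := by
  have hle : weightZero q m E F K H ≤ Subalgebra.centralizer ℂ {(K : A)} := by
    refine Algebra.adjoin_le_iff.mpr ?_
    rintro y (rfl | rfl | rfl | rfl | rfl) <;>
      simp only [SetLike.mem_coe, Subalgebra.mem_centralizer_iff, Set.mem_singleton_iff,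
        forall_eq]
    exacts [h.commute_K_casimir hq0, (Commute.refl (K : A)).units_inv_right, h.KH,
      Commute.units_inv_right h.KH]
  exact (Subalgebra.mem_centralizer_iff ℂ).mp (hle hx) _ rfl

/-- An element commuting with `K` lies in the weight zero subalgebra. -/
lemma mem_weightZero_of_commute_K (hq0 : q ≠ 0) (hq : ∀ n : ℕ, 0 < n → q ^ n ≠ 1)
    (hm : 1 ≤ m) {z : A} (hz : Commute (K : A) z) : z ∈ weightZero q m E F K H := by
  let conj : Module.End ℂ A :=
    (LinearMap.mulRight ℂ ((K⁻¹ : Aˣ) : A)) ∘ₗ (LinearMap.mulLeft ℂ (K : A))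
  have hfix : ∀ x : A, Commute (K : A) x → x ∈ conj.eigenspace 1 := by
    intro x hx
    rw [Module.End.mem_eigenspace_iff]
    change (K : A) * x * _ = _
    rw [hx.eq, mul_assoc, K.mul_inv, mul_one, one_smul]
  have hskew : ∀ (s : ℂ) (e y : A), s ≠ 1 → (K : A) * e = s • (e * K) → Commute (K : A) y →
      e * y ∈ ⨆ (j) (_ : j ≠ (1 : ℂ)), conj.eigenspace j := by
    intro s e y hs he hy
    refine Submodule.mem_iSup_of_mem s (Submodule.mem_iSup_of_mem hs ?_)
    rw [Module.End.mem_eigenspace_iff]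
    change (K : A) * (e * y) * _ = _
    rw [← mul_assoc, he, smul_mul_assoc, smul_mul_assoc, mul_assoc e, hy.eq, mul_assoc,
      mul_assoc, K.mul_inv, mul_one]
  have htop : z ∈ (weightZero q m E F K H).toSubmodule ⊔
      ⨆ (j) (_ : j ≠ (1 : ℂ)), conj.eigenspace j := by
    refine Submodule.span_le.mpr ?_ (h.mem_span_pow_mul_weightZero hq0 hq hm z)
    rintro _ ⟨d, y, hy, hx⟩
    have hy' := h.commute_K_of_mem_weightZero hq0 hy
    rcases Nat.eq_zero_or_pos d with rfl | hd
    · refine Submodule.mem_sup_left ?_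
      obtain rfl | rfl := hx <;> simpa using hy
    · refine Submodule.mem_sup_right ?_
      have hqd : (q ^ 2) ^ d ≠ 1 := by
        rw [← pow_mul]
        exact hq _ (by omega)
      obtain rfl | rfl := hx
      · exact hskew _ _ _ hqd (skew_pow_right h.KE d) hy'
      · refine hskew _ _ _ ?_ (skew_pow_right h.KF d) hy'
        rwa [inv_pow, ne_eq, inv_eq_one]
  obtain ⟨y, hy, v, hv, rfl⟩ := Submodule.mem_sup.mp htop
  have hy' : y ∈ weightZero q m E F K H := hy
  have hv1 : v ∈ conj.eigenspace 1 := by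
    have := sub_mem (hfix _ hz) (hfix y (h.commute_K_of_mem_weightZero hq0 hy'))
    rwa [add_sub_cancel_left] at this
  have hv0 : v = 0 := by
    have := (conj.eigenspaces_iSupIndep 1).le_bot ⟨hv1, hv⟩
    exact (Submodule.mem_bot ℂ).mp this
  rwa [hv0, add_zero]

lemma exists_linearCombination_eq (hq0 : q ≠ 0) {z : A}
    (hz : z ∈ weightZero q m E F K H) :
    ∃ f : ℕ × ℤ × ℤ →₀ ℂ, Finsupp.linearCombination ℂ (torusMonomial q m E F K H) f = z := by
  have hKH : Commute K H := Units.ext h.KH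
  have hΩK : ∀ (i : ℕ), Commute (casimir q m E F K H ^ i) K :=
    fun i => ((h.commute_K_casimir hq0).pow_right i).symm
  have hΩH : ∀ (i : ℕ), Commute (casimir q m E F K H ^ i) H :=
    fun i => ((h.commute_H_casimir hq0).pow_right i).symm
  have key : ∀ (u : Aˣ) (s : ℕ × ℤ × ℤ) (a b : ℤ), Commute (casimir q m E F K H ^ s.1) u →
      u * (K ^ s.2.1 * H ^ s.2.2) = K ^ a * H ^ b →
      (u : A) * torusMonomial q m E F K H s = torusMonomial q m E F K H (s.1, a, b) := by
    intro u s a b hu hab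
    simp only [torusMonomial]
    rw [← mul_assoc, ← hu.eq, mul_assoc, ← Units.val_mul, ← Units.val_mul, hab, Units.val_mul]
  have hsub : (Submonoid.closure (weightZeroGens q m E F K H) : Set A) ⊆
      Set.range (torusMonomial q m E F K H) := by
    intro x hx
    induction hx using Submonoid.closure_induction_left with
    | one => exact ⟨(0, 0, 0), by simp [torusMonomial]⟩
    | mul_left x hx y _ ih =>
      obtain ⟨s, rfl⟩ := ih
      obtain rfl | rfl | rfl | rfl | rfl := hx
      · exact ⟨(s.1 + 1, s.2), by rw [torusMonomial, pow_succ', mul_assoc]; rfl⟩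
      · refine ⟨_, (key K s (1 + s.2.1) s.2.2 (hΩK _) ?_).symm⟩
        rw [zpow_add, zpow_one, mul_assoc]
      · refine ⟨_, (key K⁻¹ s (-1 + s.2.1) s.2.2 (hΩK _).units_inv_right ?_).symm⟩
        rw [zpow_add, zpow_neg_one, mul_assoc]
      · refine ⟨_, (key H s s.2.1 (1 + s.2.2) (hΩH _) ?_).symm⟩
        rw [zpow_add, zpow_one, ← mul_assoc, ← mul_assoc, (hKH.zpow_left _).eq]
      · refine ⟨_, (key H⁻¹ s s.2.1 (-1 + s.2.2) (hΩH _).units_inv_right ?_).symm⟩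
        rw [zpow_add, zpow_neg_one, ← mul_assoc, ← mul_assoc, (hKH.zpow_left _).inv_right.eq]
  have hz' : z ∈ Subalgebra.toSubmodule (weightZero q m E F K H) := hz
  rw [weightZero, Algebra.adjoin_eq_span] at hz'
  exact (Finsupp.mem_span_range_iff_exists_finsupp).mp (Submodule.span_mono hsub hz')

end WeightZero

section LowerBorel

variable (h : QuantumRelations q m E F K H)
include h

lemma exists_E_mul_lowerBorel (hq0 : q ≠ 0) {b : A} (hb : b ∈ lowerBorel F K H) :
    ∃ b₁ ∈ lowerBorel F K H, ∃ b₂ ∈ lowerBorel F K H, E * b = b₁ * E + b₂ := by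
  have hq2 : q ^ 2 ≠ 0 := pow_ne_zero 2 hq0
  have hF : F ∈ lowerBorel F K H := Algebra.subset_adjoin (by simp)
  have hK : (K : A) ∈ lowerBorel F K H := Algebra.subset_adjoin (by simp)
  have hKi : ((K⁻¹ : Aˣ) : A) ∈ lowerBorel F K H := Algebra.subset_adjoin (by simp)
  have hH : (H : A) ∈ lowerBorel F K H := Algebra.subset_adjoin (by simp)
  have hHi : ((H⁻¹ : Aˣ) : A) ∈ lowerBorel F K H := Algebra.subset_adjoin (by simp)
  have torus : ∀ (s : ℂ) (x : A), s ≠ 0 → x ∈ lowerBorel F K H → x * E = s • (E * x) →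
      ∃ b₁ ∈ lowerBorel F K H, ∃ b₂ ∈ lowerBorel F K H, E * x = b₁ * E + b₂ := by
    intro s x hs hx hxE
    refine ⟨s⁻¹ • x, Subalgebra.smul_mem _ hx _, 0, zero_mem _, ?_⟩
    rw [smul_mul_assoc, hxE, smul_smul, inv_mul_cancel₀ hs, one_smul, add_zero]
  induction hb using Algebra.adjoin_induction with
  | mem x hx =>
    obtain rfl | rfl | rfl | rfl | rfl := hx
    · exact ⟨_, hF, _, Subalgebra.smul_mem _ (sub_mem (pow_mem hK m) (pow_mem hH m)) _, h.E_mul_F⟩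
    · exact torus _ _ hq2 hK h.KE
    · exact torus _ _ (inv_ne_zero hq2) hKi (skew_inv hq2 K.mul_inv K.inv_mul h.KE)
    · exact torus _ _ (inv_ne_zero hq2) hH h.HE
    · exact torus _ _ (inv_ne_zero (inv_ne_zero hq2)) hHi
        (skew_inv (inv_ne_zero hq2) H.mul_inv H.inv_mul h.HE)
  | algebraMap r =>
    exact ⟨_, Subalgebra.algebraMap_mem _ r, 0, zero_mem _, by
      rw [add_zero]; exact (Algebra.commutes r E).symm⟩
  | add a b _ _ ha hb =>
    obtain ⟨a₁, ha₁, a₂, ha₂, ha⟩ := ha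
    obtain ⟨b₁, hb₁, b₂, hb₂, hb⟩ := hb
    refine ⟨a₁ + b₁, add_mem ha₁ hb₁, a₂ + b₂, add_mem ha₂ hb₂, ?_⟩
    rw [mul_add, ha, hb, add_mul]
    abel
  | mul a b _ hbB ha hb =>
    obtain ⟨a₁, ha₁, a₂, ha₂, ha⟩ := ha
    obtain ⟨b₁, hb₁, b₂, hb₂, hb⟩ := hb
    refine ⟨a₁ * b₁, mul_mem ha₁ hb₁, a₁ * b₂ + a₂ * b,
      add_mem (mul_mem ha₁ hb₂) (mul_mem ha₂ hbB), ?_⟩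
    rw [← mul_assoc, ha, add_mul, mul_assoc a₁, hb, mul_add]
    simp only [mul_assoc, add_assoc]

/-- Every element is congruent to an element of `B` modulo the left ideal generated
by `E - c`. -/
lemma exists_sub_mem_span (hq0 : q ≠ 0) (c : ℂ) (u : A) :
    ∃ b ∈ lowerBorel F K H, u - b ∈ Submodule.span A {E - algebraMap ℂ A c} := by
  set L := Submodule.span A {E - algebraMap ℂ A c} with hL
  have hmem : E - algebraMap ℂ A c ∈ L := Submodule.mem_span_singleton_self _
  let N : Submodule ℂ A := (lowerBorel F K H).toSubmodule ⊔ L.restrictScalars ℂ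
  have hBN : ∀ x ∈ lowerBorel F K H, x ∈ N := fun x hx => Submodule.mem_sup_left hx
  have hLN : ∀ x ∈ L, x ∈ N := fun x hx => Submodule.mem_sup_right hx
  have hmul : ∀ x ∈ lowerBorel F K H, ∀ y ∈ N, x * y ∈ N := by
    intro x hx y hy
    obtain ⟨b, hb, l, hl, rfl⟩ := Submodule.mem_sup.mp hy
    rw [mul_add]
    exact N.add_mem (hBN _ (mul_mem hx hb)) (hLN _ (L.smul_mem x hl))
  have huN : u ∈ N := by
    refine mem_of_adjoin_eq_top_of_mul_mem h.adjoin_eq_top N (hBN 1 (one_mem _)) ?_ u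
    intro x hx y hy
    rw [Set.mem_insert_iff] at hx
    obtain rfl | hx := hx
    · obtain ⟨b, hb, l, hl, rfl⟩ := Submodule.mem_sup.mp hy
      obtain ⟨b₁, hb₁, b₂, hb₂, hE⟩ := h.exists_E_mul_lowerBorel hq0 hb
      have : x * b = (c • b₁ + b₂) + b₁ * (x - algebraMap ℂ A c) := by
        rw [hE, mul_sub, ← Algebra.commutes c b₁, ← Algebra.smul_def]
        abel
      rw [mul_add, this]
      exact N.add_mem (N.add_mem (hBN _ (add_mem (Subalgebra.smul_mem _ hb₁ c) hb₂))
        (hLN _ (L.smul_mem b₁ hmem))) (hLN _ (L.smul_mem x hl))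
    · exact hmul x (Algebra.subset_adjoin hx) y hy
  obtain ⟨b, hb, l, hl, rfl⟩ := Submodule.mem_sup.mp huN
  exact ⟨b, hb, by rwa [add_sub_cancel_left]⟩

end LowerBorel

end QuantumRelations
/-! ### A representation with a Whittaker vector -/

section Representation

/-- The commutative coefficient ring `ℂ[ω, k^{±1}, h^{±1}]`. -/
abbrev CoeffRing : Type := AddMonoidAlgebra ℂ (ℕ × ℤ × ℤ)

/-- The monomial `ω^i k^a h^b`. -/
noncomputable def coeffMonomial (t : ℕ × ℤ × ℤ) : CoeffRing := AddMonoidAlgebra.single t 1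

/-- The space of functions `ℤ → ℂ[ω, k^{±1}, h^{±1}]` on which `U_q(f_m(K,H))` acts. -/
abbrev RepSpace : Type := ℤ → CoeffRing

/-- The action of `E`, by a shift. -/
noncomputable def repE : Module.End ℂ RepSpace := LinearMap.funLeft ℂ CoeffRing (fun n => n - 1)

/-- The action of `K^a H^b`, by multiplication. -/
noncomputable def repTorus (q : ℂ) (a b : ℤ) : Module.End ℂ RepSpace :=
  LinearMap.mulLeft ℂ (fun n => q ^ (2 * n * (a - b)) • coeffMonomial (0, a, b))

/-- The eigenvalue of the torus part of the Casimir element at the coordinate `n`. -/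
noncomputable def repCasimirTorus (q : ℂ) (m : ℕ) (n : ℤ) : CoeffRing :=
  ((q ^ (2 * m) - 1) * (q - q⁻¹))⁻¹ •
    (q ^ (2 * m) • q ^ (2 * n * m) • coeffMonomial (0, m, 0) +
      q ^ (-(2 * n * m)) • coeffMonomial (0, 0, m))

/-- The action of `F`. -/
noncomputable def repF (q : ℂ) (m : ℕ) : Module.End ℂ RepSpace :=
  LinearMap.mulLeft ℂ (fun n => coeffMonomial (1, 0, 0) - repCasimirTorus q m n) ∘ₗ
    LinearMap.funLeft ℂ CoeffRing (fun n => n + 1)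

lemma coeffMonomial_mul (s t : ℕ × ℤ × ℤ) :
    coeffMonomial s * coeffMonomial t = coeffMonomial (s + t) := by
  simp [coeffMonomial, AddMonoidAlgebra.single_mul_single]

lemma repE_apply (v : RepSpace) (n : ℤ) : repE v n = v (n - 1) := rfl

lemma repTorus_apply (q : ℂ) (a b : ℤ) (v : RepSpace) (n : ℤ) :
    repTorus q a b v n = (q ^ (2 * n * (a - b)) • coeffMonomial (0, a, b)) * v n := rfl

lemma repF_apply (q : ℂ) (m : ℕ) (v : RepSpace) (n : ℤ) :
    repF q m v n = (coeffMonomial (1, 0, 0) - repCasimirTorus q m n) * v (n + 1) := rfl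

variable {q : ℂ} (hq0 : q ≠ 0)

lemma repTorus_zero : repTorus q 0 0 = 1 := by
  refine LinearMap.ext fun v => funext fun n => ?_
  rw [repTorus_apply]
  have : coeffMonomial (0, 0, 0) = 1 := rfl
  simp [this]

include hq0

lemma repTorus_mul (a b a' b' : ℤ) :
    repTorus q a b * repTorus q a' b' = repTorus q (a + a') (b + b') := by
  refine LinearMap.ext fun v => funext fun n => ?_
  rw [Module.End.mul_apply, repTorus_apply, repTorus_apply, repTorus_apply, ← mul_assoc,
    smul_mul_smul_comm, coeffMonomial_mul, ← zpow_add₀ hq0]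
  congr 3
  ring

lemma repTorus_pow (a b : ℤ) (n : ℕ) : repTorus q a b ^ n = repTorus q (n * a) (n * b) := by
  induction n with
  | zero => simp [repTorus_zero]
  | succ n ih =>
    rw [pow_succ, ih, repTorus_mul hq0]
    congr 1 <;>
      · push_cast
        ring

lemma repTorus_mul_repE (a b : ℤ) :
    repTorus q a b * repE = q ^ (2 * (a - b)) • (repE * repTorus q a b) := by
  refine LinearMap.ext fun v => funext fun n => ?_
  rw [Module.End.mul_apply, LinearMap.smul_apply, Pi.smul_apply, Module.End.mul_apply,
    repTorus_apply, repE_apply, repE_apply, repTorus_apply, ← smul_mul_assoc, smul_smul,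
    ← zpow_add₀ hq0]
  congr 3
  ring

lemma repTorus_mul_repF (m : ℕ) (a b : ℤ) :
    repTorus q a b * repF q m = (q ^ (2 * (a - b)))⁻¹ • (repF q m * repTorus q a b) := by
  refine LinearMap.ext fun v => funext fun n => ?_
  rw [Module.End.mul_apply, LinearMap.smul_apply, Pi.smul_apply, Module.End.mul_apply,
    repTorus_apply, repF_apply, repF_apply, repTorus_apply, mul_left_comm, ← mul_smul_comm,
    ← smul_mul_assoc, smul_smul, ← zpow_neg, ← zpow_add₀ hq0]
  congr 4
  ring

lemma repCasimirTorus_sub (hq : ∀ n : ℕ, 0 < n → q ^ n ≠ 1) {m : ℕ} (hm : 1 ≤ m) (n : ℤ) :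
    repCasimirTorus q m n - repCasimirTorus q m (n - 1) =
      (q - q⁻¹)⁻¹ • (q ^ (2 * n * m) • coeffMonomial (0, m, 0) -
        q ^ (-(2 * n * m)) • coeffMonomial (0, 0, m)) := by
  have h1 := q_sub_inv_ne_zero hq0 hq
  have h2 : q ^ (2 * m) - 1 ≠ 0 := sub_ne_zero.mpr (hq _ (by omega))
  have h3 : q ^ (2 * m) ≠ 0 := pow_ne_zero _ hq0
  have h4 : q ^ (2 * (n - 1) * m) = q ^ (2 * n * m) * (q ^ (2 * m))⁻¹ := by
    rw [← zpow_natCast q (2 * m), ← zpow_neg, ← zpow_add₀ hq0]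
    congr 1
    push_cast
    ring
  have h5 : q ^ (2 * n * m) ≠ 0 := zpow_ne_zero _ hq0
  simp only [repCasimirTorus, zpow_neg, h4]
  generalize q - q⁻¹ = d at h1 ⊢
  generalize q ^ (2 * n * m) = P at h5 ⊢
  generalize q ^ (2 * m) = Q at h2 h3 ⊢
  match_scalars
  all_goals field_simp
  all_goals ring

lemma repE_mul_repF_sub (hq : ∀ n : ℕ, 0 < n → q ^ n ≠ 1) {m : ℕ} (hm : 1 ≤ m) :
    repE * repF q m - repF q m * repE =
      (q - q⁻¹)⁻¹ • (repTorus q 1 0 ^ m - repTorus q 0 1 ^ m) := by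
  rw [repTorus_pow hq0, repTorus_pow hq0]
  refine LinearMap.ext fun v => funext fun n => ?_
  simp only [LinearMap.sub_apply, LinearMap.smul_apply, Pi.sub_apply, Pi.smul_apply,
    Module.End.mul_apply, repE_apply, repF_apply, repTorus_apply, mul_one, mul_zero, sub_zero,
    zero_sub, sub_add_cancel, add_sub_cancel_right, mul_neg]
  rw [← sub_mul, ← sub_mul, ← smul_mul_assoc, ← repCasimirTorus_sub hq0 hq hm,
    sub_sub_sub_cancel_left]

lemma repF_mul_repE_add (m : ℕ) :
    repF q m * repE + ((q ^ (2 * m) - 1) * (q - q⁻¹))⁻¹ •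
      (q ^ (2 * m) • repTorus q 1 0 ^ m + repTorus q 0 1 ^ m) =
        LinearMap.mulLeft ℂ (fun _ => coeffMonomial (1, 0, 0)) := by
  rw [repTorus_pow hq0, repTorus_pow hq0]
  refine LinearMap.ext fun v => funext fun n => ?_
  simp only [LinearMap.add_apply, LinearMap.smul_apply, Pi.add_apply, Pi.smul_apply,
    Module.End.mul_apply, repE_apply, repF_apply, repTorus_apply, mul_one, mul_zero, sub_zero,
    zero_sub, add_sub_cancel_right, mul_neg, LinearMap.mulLeft_apply, Pi.mul_apply]
  rw [← smul_mul_assoc, ← add_mul, ← smul_mul_assoc, ← add_mul, repCasimirTorus, sub_add_cancel]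

omit hq0 in
/-- The images of the generators under the representation. -/
noncomputable def repGen (q : ℂ) (m : ℕ) : Gen → Module.End ℂ RepSpace
  | Gen.E => repE
  | Gen.F => repF q m
  | Gen.K => repTorus q 1 0
  | Gen.Kinv => repTorus q (-1) 0
  | Gen.H => repTorus q 0 1
  | Gen.Hinv => repTorus q 0 (-1)

lemma repGen_rel (hq : ∀ n : ℕ, 0 < n → q ^ n ≠ 1) {m : ℕ} (hm : 1 ≤ m) ⦃x y : FA⦄
    (hxy : URel q (fm q m) x y) :
    FreeAlgebra.lift ℂ (repGen q m) x = FreeAlgebra.lift ℂ (repGen q m) y := by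
  cases hxy <;> simp only [gE, gF, gK, gKi, gH, gHi, fm, map_mul, map_sub, map_smul, map_pow,
    map_one, FreeAlgebra.lift_ι_apply, repGen]
  case KKi => rw [repTorus_mul hq0]; exact repTorus_zero
  case KiK => rw [repTorus_mul hq0]; exact repTorus_zero
  case HHi => rw [repTorus_mul hq0]; exact repTorus_zero
  case HiH => rw [repTorus_mul hq0]; exact repTorus_zero
  case KH => rw [repTorus_mul hq0, repTorus_mul hq0]; rfl
  case KE => exact repTorus_mul_repE hq0 1 0
  case KF => exact repTorus_mul_repF hq0 m 1 0
  case HE =>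
    rw [repTorus_mul_repE hq0, zero_sub, mul_neg, zpow_neg]; rfl
  case HF =>
    rw [repTorus_mul_repF hq0, zero_sub, mul_neg, zpow_neg, inv_inv]; rfl
  case EF => exact repE_mul_repF_sub hq0 hq hm

omit hq0 in
/-- The representation of `U_q(f_m(K,H))` on functions `ℤ → ℂ[ω, k^{±1}, h^{±1}]`. -/
noncomputable def rep (hq0 : q ≠ 0) (hq : ∀ n : ℕ, 0 < n → q ^ n ≠ 1) {m : ℕ} (hm : 1 ≤ m) :
    Um q m →ₐ[ℂ] Module.End ℂ RepSpace :=
  RingQuot.liftAlgHom ℂ ⟨FreeAlgebra.lift ℂ (repGen q m), repGen_rel hq0 hq hm⟩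

end Representation

section Generators

variable (q : ℂ) (m : ℕ)

/-- The generator `K` as a unit. -/
noncomputable def uKUnit : (Um q m)ˣ where
  val := uK q (fm q m)
  inv := uKi q (fm q m)
  val_inv := by
    rw [uK, uKi, ← map_mul, RingQuot.mkAlgHom_rel ℂ URel.KKi, map_one]
  inv_val := by
    rw [uK, uKi, ← map_mul, RingQuot.mkAlgHom_rel ℂ URel.KiK, map_one]

/-- The generator `H` as a unit. -/
noncomputable def uHUnit : (Um q m)ˣ where
  val := uH q (fm q m)
  inv := uHi q (fm q m)
  val_inv := by
    rw [uH, uHi, ← map_mul, RingQuot.mkAlgHom_rel ℂ URel.HHi, map_one]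
  inv_val := by
    rw [uH, uHi, ← map_mul, RingQuot.mkAlgHom_rel ℂ URel.HiH, map_one]

lemma adjoin_generators_eq_top :
    Algebra.adjoin ℂ {uE q (fm q m), uF q (fm q m), uK q (fm q m), uKi q (fm q m),
      uH q (fm q m), uHi q (fm q m)} = ⊤ := by
  rw [eq_top_iff, ← (AlgHom.range_eq_top _).mpr (RingQuot.mkAlgHom_surjective ℂ (URel q (fm q m))),
    ← Algebra.map_top, ← FreeAlgebra.adjoin_range_ι, AlgHom.map_adjoin]
  refine Algebra.adjoin_mono ?_
  rintro _ ⟨_, ⟨g, rfl⟩, rfl⟩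
  cases g
  · exact Or.inl rfl
  · exact Or.inr (Or.inl rfl)
  · exact Or.inr (Or.inr (Or.inl rfl))
  · exact Or.inr (Or.inr (Or.inr (Or.inl rfl)))
  · exact Or.inr (Or.inr (Or.inr (Or.inr (Or.inl rfl))))
  · exact Or.inr (Or.inr (Or.inr (Or.inr (Or.inr rfl))))

lemma quantumRelations_Um :
    QuantumRelations q m (uE q (fm q m)) (uF q (fm q m)) (uKUnit q m) (uHUnit q m) where
  KH := by
    change uK _ _ * uH _ _ = uH _ _ * uK _ _
    rw [uK, uH, ← map_mul, RingQuot.mkAlgHom_rel ℂ URel.KH, map_mul]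
  KE := by
    change uK _ _ * uE _ _ = _ • (uE _ _ * uK _ _)
    rw [uK, uE, ← map_mul, RingQuot.mkAlgHom_rel ℂ URel.KE, map_smul, map_mul]
  KF := by
    change uK _ _ * uF _ _ = _ • (uF _ _ * uK _ _)
    rw [uK, uF, ← map_mul, RingQuot.mkAlgHom_rel ℂ URel.KF, map_smul, map_mul]
  HE := by
    change uH _ _ * uE _ _ = _ • (uE _ _ * uH _ _)
    rw [uH, uE, ← map_mul, RingQuot.mkAlgHom_rel ℂ URel.HE, map_smul, map_mul]
  HF := by
    change uH _ _ * uF _ _ = _ • (uF _ _ * uH _ _)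
    rw [uH, uF, ← map_mul, RingQuot.mkAlgHom_rel ℂ URel.HF, map_smul, map_mul]
  EF := by
    change _ = _ • (uK _ _ ^ m - uH _ _ ^ m)
    rw [uK, uE, uF, uH, ← map_mul, ← map_mul, ← map_sub, RingQuot.mkAlgHom_rel ℂ URel.EF,
      fm, map_smul, map_sub, map_pow, map_pow]
  adjoin_eq_top := adjoin_generators_eq_top q m

end Generators
section Generators

variable (q : ℂ) (m : ℕ)

lemma commute_uKUnit_uHUnit : Commute (uKUnit q m) (uHUnit q m) :=
  Units.ext (quantumRelations_Um q m).KH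

lemma uKi_mul_uHi : uKi q (fm q m) * uHi q (fm q m) =
    (((uKUnit q m * uHUnit q m)⁻¹ : (Um q m)ˣ) : Um q m) := by
  rw [(commute_uKUnit_uHUnit q m).eq, mul_inv_rev]; rfl

lemma OmEta_mem_Bsub (c : ℂ) : OmEta q m c ∈ Bsub q m := by
  have hF : uF q (fm q m) ∈ Bsub q m := Algebra.subset_adjoin (by simp)
  have hK : uK q (fm q m) ∈ Bsub q m := Algebra.subset_adjoin (by simp)
  have hH : uH q (fm q m) ∈ Bsub q m := Algebra.subset_adjoin (by simp)
  exact add_mem (mul_mem (Subalgebra.algebraMap_mem _ c) hF) (Subalgebra.smul_mem _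
    (add_mem (Subalgebra.smul_mem _ (pow_mem hK m) _) (pow_mem hH m)) _)

lemma uK_mul_uH_mem_Bsub : uK q (fm q m) * uH q (fm q m) ∈ Bsub q m :=
  mul_mem (Algebra.subset_adjoin (by simp)) (Algebra.subset_adjoin (by simp))

lemma uKi_mul_uHi_mem_Bsub : uKi q (fm q m) * uHi q (fm q m) ∈ Bsub q m :=
  mul_mem (Algebra.subset_adjoin (by simp)) (Algebra.subset_adjoin (by simp))

end Generators

section Whittaker

variable {q : ℂ} {m : ℕ} (hq0 : q ≠ 0) (hq : ∀ n : ℕ, 0 < n → q ^ n ≠ 1) (hm : 1 ≤ m)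

lemma rep_uE : rep hq0 hq hm (uE q (fm q m)) = repE := by
  rw [rep, uE, RingQuot.liftAlgHom_mkAlgHom_apply, gE, FreeAlgebra.lift_ι_apply, repGen]

lemma rep_uF : rep hq0 hq hm (uF q (fm q m)) = repF q m := by
  rw [rep, uF, RingQuot.liftAlgHom_mkAlgHom_apply, gF, FreeAlgebra.lift_ι_apply, repGen]

lemma rep_uK : rep hq0 hq hm (uK q (fm q m)) = repTorus q 1 0 := by
  rw [rep, uK, RingQuot.liftAlgHom_mkAlgHom_apply, gK, FreeAlgebra.lift_ι_apply, repGen]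

lemma rep_uH : rep hq0 hq hm (uH q (fm q m)) = repTorus q 0 1 := by
  rw [rep, uH, RingQuot.liftAlgHom_mkAlgHom_apply, gH, FreeAlgebra.lift_ι_apply, repGen]

lemma rep_Om : rep hq0 hq hm (Om q m) =
    LinearMap.mulLeft ℂ (fun _ => coeffMonomial (1, 0, 0)) := by
  rw [Om, map_add, map_mul, map_smul, map_add, map_smul, map_pow, map_pow, rep_uE, rep_uF,
    rep_uK, rep_uH, repF_mul_repE_add hq0]

/-- The homomorphism `(a, b) ↦ repTorus q a b` restricted to a line. -/
noncomputable def repTorusHom (hq0 : q ≠ 0) (a b : ℤ) :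
    Multiplicative ℤ →* Module.End ℂ RepSpace where
  toFun n := repTorus q (n.toAdd * a) (n.toAdd * b)
  map_one' := by simp [repTorus_zero]
  map_mul' x y := by rw [repTorus_mul hq0, toAdd_mul, add_mul, add_mul]

lemma rep_units_zpow {u : (Um q m)ˣ} {a b : ℤ}
    (hu : rep hq0 hq hm (u : Um q m) = repTorus q a b) (n : ℤ) :
    rep hq0 hq hm ((u ^ n : (Um q m)ˣ) : Um q m) = repTorus q (n * a) (n * b) := by
  have : ((rep hq0 hq hm : Um q m →* Module.End ℂ RepSpace).comp (Units.coeHom (Um q m))).comp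
      (zpowersHom _ u) = repTorusHom hq0 a b := by
    refine MonoidHom.ext_mint ?_
    simpa [repTorusHom] using hu
  simpa [repTorusHom] using DFunLike.congr_fun this (Multiplicative.ofAdd n)

/-- A vector on which `E` acts by the scalar `c`. -/
noncomputable def whittakerVector (c : ℂ) : RepSpace := fun n => c ^ (-n) • 1

lemma repE_whittakerVector {c : ℂ} (hc : c ≠ 0) :
    repE (whittakerVector c) = c • whittakerVector c := by
  funext n
  rw [repE_apply, Pi.smul_apply, whittakerVector, whittakerVector, smul_smul,
    ← zpow_one_add₀ hc]
  congr 2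
  ring

lemma rep_torusMonomial (t : ℕ × ℤ × ℤ) (v : RepSpace) (n : ℤ) :
    rep hq0 hq hm (torusMonomial q m (uE q (fm q m)) (uF q (fm q m)) (uKUnit q m) (uHUnit q m) t)
      v n = (q ^ (2 * n * (t.2.1 - t.2.2)) • coeffMonomial t) * v n := by
  have hΩ : rep hq0 hq hm (casimir q m (uE q (fm q m)) (uF q (fm q m)) (uKUnit q m)
      (uHUnit q m)) = LinearMap.mulLeft ℂ (fun _ => coeffMonomial (1, 0, 0)) :=
    rep_Om hq0 hq hm
  have hpow : ∀ i : ℕ, coeffMonomial (1, 0, 0) ^ i = coeffMonomial (i, 0, 0) := fun i => by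
    simp [coeffMonomial, AddMonoidAlgebra.single_pow]
  rw [torusMonomial, map_mul, map_mul, map_pow, hΩ, rep_units_zpow hq0 hq hm (rep_uK hq0 hq hm),
    rep_units_zpow hq0 hq hm (rep_uH hq0 hq hm), repTorus_mul hq0, LinearMap.pow_mulLeft,
    Module.End.mul_apply, LinearMap.mulLeft_apply, Pi.mul_apply, Pi.pow_apply, repTorus_apply,
    hpow, ← mul_assoc, mul_smul_comm, coeffMonomial_mul]
  have ht : ((t.1, 0, 0) + (0, t.2.1 * 1 + t.2.2 * 0, t.2.1 * 0 + t.2.2 * 1) : ℕ × ℤ × ℤ) = t := by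
    ext <;> simp
  rw [ht]
  simp

lemma coeff_rep_linearCombination (c : ℂ) (f : ℕ × ℤ × ℤ →₀ ℂ) (n : ℤ) (t : ℕ × ℤ × ℤ) :
    (rep hq0 hq hm (Finsupp.linearCombination ℂ (torusMonomial q m (uE q (fm q m))
      (uF q (fm q m)) (uKUnit q m) (uHUnit q m)) f) (whittakerVector c) n).coeff t =
      f t * (q ^ (2 * n * (t.2.1 - t.2.2)) * c ^ (-n)) := by
  classical
  induction f using Finsupp.induction_linear with
  | zero => simp
  | add f g hf hg =>
    rw [map_add, map_add, LinearMap.add_apply, Pi.add_apply, AddMonoidAlgebra.coeff_add,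
      Finsupp.add_apply, hf, hg, Finsupp.add_apply, add_mul]
  | single s r =>
    rw [Finsupp.linearCombination_single, map_smul, LinearMap.smul_apply, Pi.smul_apply,
      rep_torusMonomial, whittakerVector, mul_smul_comm, mul_one, coeffMonomial]
    by_cases hst : s = t
    · subst hst
      simp [mul_comm]
    · simp [hst]

/-- A linear projection onto a subalgebra along a left ideal is multiplicative on products with
a central right factor. -/
lemma projection_mul {A : Type*} [Ring A] [Algebra ℂ A] {B : Subalgebra ℂ A}
    {L : Submodule A A} {p : A →ₗ[ℂ] A} (hpB : ∀ x, p x ∈ B) (hpid : ∀ b ∈ B, p b = b)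
    (hpL : ∀ x ∈ L, p x = 0) (hsub : ∀ x, x - p x ∈ L) (x : A) {z : A}
    (hz : z ∈ Subalgebra.center ℂ A) : p (x * z) = p x * p z := by
  have hmem : x * z - p x * p z ∈ L := by
    have : x * z - p x * p z = z * (x - p x) + p x * (z - p z) := by
      rw [mul_sub, mul_sub, ← Subalgebra.mem_center_iff.mp hz, ← Subalgebra.mem_center_iff.mp hz]
      abel
    rw [this]
    exact add_mem (L.smul_mem z (hsub x)) (L.smul_mem (p x) (hsub z))
  have := hpL _ hmem
  rwa [map_sub, sub_eq_zero, hpid _ (mul_mem (hpB x) (hpB z))] at this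

include hq0 hq hm

lemma eq_zero_of_mem_center_of_mem_Lc {c : ℂ} (hc : c ≠ 0) {z : Um q m}
    (hz : z ∈ Subalgebra.center ℂ (Um q m)) (hzL : z ∈ Lc q m c) : z = 0 := by
  have h := quantumRelations_Um q m
  obtain ⟨f, hf⟩ := h.exists_linearCombination_eq hq0
    (h.mem_weightZero_of_commute_K hq0 hq hm ((Subalgebra.mem_center_iff.mp hz _)))
  obtain ⟨u, hu⟩ := Submodule.mem_span_singleton.mp hzL
  have hzw : rep hq0 hq hm z (whittakerVector c) = 0 := by
    rw [← hu, smul_eq_mul, map_mul, map_sub, rep_uE, AlgHom.commutes, Module.End.mul_apply,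
      LinearMap.sub_apply, repE_whittakerVector hc, Module.algebraMap_end_apply, sub_self,
      map_zero]
  have hf0 : f = 0 := by
    ext t
    have := coeff_rep_linearCombination hq0 hq hm c f 0 t
    rw [hf, hzw] at this
    simpa using this.symm
  rw [← hf, hf0, map_zero]

lemma center_le_adjoin {z : Um q m} (hz : z ∈ Subalgebra.center ℂ (Um q m)) :
    z ∈ Algebra.adjoin ℂ {Om q m, uK q (fm q m) * uH q (fm q m),
      uKi q (fm q m) * uHi q (fm q m)} := by
  have h := quantumRelations_Um q m
  obtain ⟨f, hf⟩ := h.exists_linearCombination_eq hq0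
    (h.mem_weightZero_of_commute_K hq0 hq hm ((Subalgebra.mem_center_iff.mp hz _)))
  have hzw : repE (rep hq0 hq hm z (whittakerVector 1)) =
      rep hq0 hq hm z (whittakerVector 1) := by
    have := congrArg (fun x => rep hq0 hq hm x (whittakerVector 1))
      (Subalgebra.mem_center_iff.mp hz (uE q (fm q m)))
    simpa only [map_mul, rep_uE, Module.End.mul_apply, repE_whittakerVector one_ne_zero,
      one_smul] using this
  have hdiag : ∀ t ∈ f.support, t.2.1 = t.2.2 := by
    intro t ht
    by_contra hne
    have h0 := coeff_rep_linearCombination hq0 hq hm 1 f 0 t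
    have h1 := coeff_rep_linearCombination hq0 hq hm 1 f 1 t
    rw [hf] at h0 h1
    have h2 : rep hq0 hq hm z (whittakerVector 1) 0 = rep hq0 hq hm z (whittakerVector 1) 1 :=
      congrFun hzw 1
    rw [← h2, h0] at h1
    refine q_zpow_ne_one hq (n := 2 * (t.2.1 - t.2.2)) (by omega) ?_
    refine mul_left_cancel₀ (Finsupp.mem_support_iff.mp ht) ?_
    simpa using h1.symm
  have hcomm := commute_uKUnit_uHUnit q m
  set S := Algebra.adjoin ℂ {Om q m, uK q (fm q m) * uH q (fm q m),
      uKi q (fm q m) * uHi q (fm q m)} with hS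
  have hΩS : Om q m ∈ S := Algebra.subset_adjoin (by simp)
  have hKHS : uK q (fm q m) * uH q (fm q m) ∈ S := Algebra.subset_adjoin (by simp)
  have hKHiS : uKi q (fm q m) * uHi q (fm q m) ∈ S := Algebra.subset_adjoin (by simp)
  have hpow : ∀ a : ℤ, (((uKUnit q m * uHUnit q m) ^ a : (Um q m)ˣ) : Um q m) ∈ S := by
    intro a
    obtain ⟨k, rfl | rfl⟩ := a.eq_nat_or_neg
    · rw [zpow_natCast, Units.val_pow_eq_pow_val]
      exact pow_mem hKHS k
    · rw [zpow_neg, zpow_natCast, ← inv_pow, Units.val_pow_eq_pow_val,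
        ← uKi_mul_uHi]
      exact pow_mem hKHiS k
  rw [← hf, Finsupp.linearCombination_apply, Finsupp.sum]
  refine sum_mem fun t ht => Subalgebra.smul_mem _ ?_ _
  rw [torusMonomial, hdiag t ht, ← Units.val_mul, ← hcomm.mul_zpow]
  exact mul_mem (pow_mem hΩS _) (hpow _)

end Whittaker
/-- Let `p : U → B` be the ℂ-linear projection onto `B` along `U(E - c)`
(relative to `U = B ⊕ U(E - c)`). Then `p` restricted to the center `Z(U)` is an injective
algebra homomorphism with image the subalgebra `W` generated by
`cF + (q^{2m}K^m + H^m)/((q^{2m} - 1)(q - q⁻¹))`, `KH`, `(KH)⁻¹`; in particular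
`p(Ω) = cF + (q^{2m}K^m + H^m)/((q^{2m} - 1)(q - q⁻¹))`. -/
theorem stmt14 (q : ℂ) (hq0 : q ≠ 0) (hq : ∀ n : ℕ, 0 < n → q ^ n ≠ 1)
    (m : ℕ) (hm : 1 ≤ m) (c : ℂ) (hc : c ≠ 0)
    (p : Um q m →ₗ[ℂ] Um q m)
    (hpB : ∀ x : Um q m, p x ∈ Bsub q m)
    (hpid : ∀ b ∈ Bsub q m, p b = b)
    (hpL : ∀ x ∈ Lc q m c, p x = 0) :
    Set.InjOn p (Subalgebra.center ℂ (Um q m) : Set (Um q m)) ∧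
    (∀ z₁ ∈ Subalgebra.center ℂ (Um q m), ∀ z₂ ∈ Subalgebra.center ℂ (Um q m),
      p (z₁ * z₂) = p z₁ * p z₂) ∧
    p 1 = 1 ∧
    p '' (Subalgebra.center ℂ (Um q m) : Set (Um q m)) = (Wsub q m c : Set (Um q m)) ∧
    p (Om q m) = OmEta q m c := by
  have h := quantumRelations_Um q m
  have hadd : Om q m - OmEta q m c = uF q (fm q m) * (uE q (fm q m) - algebraMap ℂ (Um q m) c) := by
    rw [Om, OmEta, add_sub_add_right_eq_sub, mul_sub,
      Algebra.commutes c (uF q (fm q m) : Um q m)]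
  have hsub : ∀ u : Um q m, u - p u ∈ Lc q m c := by
    intro u
    obtain ⟨b, hb, hub⟩ := h.exists_sub_mem_span hq0 c u
    have hpu : p u = b := by
      have := hpL _ hub
      rwa [map_sub, sub_eq_zero, hpid b hb] at this
    rwa [hpu]
  have hmul : ∀ z₁, ∀ z₂ ∈ Subalgebra.center ℂ (Um q m), p (z₁ * z₂) = p z₁ * p z₂ :=
    fun z₁ z₂ hz₂ => projection_mul hpB hpid hpL hsub z₁ hz₂
  have hpΩ : p (Om q m) = OmEta q m c := by
    have hL : Om q m - OmEta q m c ∈ Lc q m c := by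
      rw [hadd]
      exact (Lc q m c).smul_mem _ (Submodule.mem_span_singleton_self _)
    have := hpL _ hL
    rwa [map_sub, sub_eq_zero, hpid _ (OmEta_mem_Bsub q m c)] at this
  have hKH := h.K_mul_H_mem_center hq0
  have hcen : ∀ x ∈ ({Om q m, uK q (fm q m) * uH q (fm q m),
      uKi q (fm q m) * uHi q (fm q m)} : Set (Um q m)),
      x ∈ Subalgebra.center ℂ (Um q m) := by
    rintro x (rfl | rfl | rfl)
    · exact h.casimir_mem_center hq0 hq hm
    · exact hKH
    · exact uKi_mul_uHi q m ▸ QuantumRelations.units_inv_mem_center hKH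
  have hcenter : Subalgebra.center ℂ (Um q m) = Algebra.adjoin ℂ {Om q m,
      uK q (fm q m) * uH q (fm q m), uKi q (fm q m) * uHi q (fm q m)} :=
    le_antisymm (fun z hz => center_le_adjoin hq0 hq hm hz) (Algebra.adjoin_le hcen)
  refine ⟨?_, fun z₁ _ z₂ hz₂ => hmul z₁ z₂ hz₂, hpid 1 (one_mem _), ?_, hpΩ⟩
  · intro z₁ hz₁ z₂ hz₂ heq
    rw [← sub_eq_zero]
    refine eq_zero_of_mem_center_of_mem_Lc hq0 hq hm hc (sub_mem hz₁ hz₂) ?_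
    have := hsub (z₁ - z₂)
    rwa [map_sub, heq, sub_self, sub_zero] at this
  · refine Set.Subset.antisymm ?_ ?_
    · rintro _ ⟨z, hz, rfl⟩
      rw [SetLike.mem_coe, hcenter] at hz
      induction hz using Algebra.adjoin_induction with
      | mem x hx =>
        obtain rfl | rfl | rfl := hx
        · rw [hpΩ]
          exact Algebra.subset_adjoin (by simp)
        · rw [hpid _ (uK_mul_uH_mem_Bsub q m)]
          exact Algebra.subset_adjoin (by simp)
        · rw [hpid _ (uKi_mul_uHi_mem_Bsub q m)]
          exact Algebra.subset_adjoin (by simp)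
      | algebraMap r =>
        rw [hpid _ (Subalgebra.algebraMap_mem _ r)]
        exact Subalgebra.algebraMap_mem _ r
      | add a b _ _ ha hb =>
        rw [map_add]
        exact add_mem ha hb
      | mul a b _ hbS ha hb =>
        rw [hmul a b (hcenter ▸ hbS)]
        exact mul_mem ha hb
    · intro w hw
      induction hw using Algebra.adjoin_induction with
      | mem x hx =>
        obtain rfl | rfl | rfl := hx
        · exact ⟨_, hcen _ (by simp), hpΩ⟩
        · exact ⟨_, hcen _ (by simp), hpid _ (uK_mul_uH_mem_Bsub q m)⟩
        · exact ⟨_, hcen _ (by simp), hpid _ (uKi_mul_uHi_mem_Bsub q m)⟩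
      | algebraMap r =>
        exact ⟨_, Subalgebra.algebraMap_mem _ r, hpid _ (Subalgebra.algebraMap_mem _ r)⟩
      | add a b _ _ ha hb =>
        obtain ⟨x, hx, rfl⟩ := ha
        obtain ⟨y, hy, rfl⟩ := hb
        exact ⟨x + y, add_mem hx hy, map_add p x y⟩
      | mul a b _ _ ha hb =>
        obtain ⟨x, hx, rfl⟩ := ha
        obtain ⟨y, hy, rfl⟩ := hb
        exact ⟨x * y, mul_mem hx hy, hmul x y hy⟩
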